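/- For any alphabet X, the double sum over all pairs of integer partitions satisfies Σ_{μ,τ} z^{|μ|} s_{μ/τ}(X) = ∏_{k≥1} Φ(z^k X)/(1−z^k), as an identity of formal power series, where z^k X denotes the alphabet X with every variable multiplied by z^k. -/

import Mathlib

open scoped BigOperators

/-- An integer partition: a weakly decreasing, finitely supported sequence of
nonnegative integers. -/
structure Ptn where
  toFun : ℕ →₀ ℕ
  antitone' : ∀ ⦃i j : ℕ⦄, i ≤ j → toFun j ≤ toFun i

namespace Ptn
/-- the `i`-th part (0-indexed) -/
def part (lam : Ptn) (i : ℕ) : ℕ := lam.toFun i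
/-- the size `|λ|` -/
def size (lam : Ptn) : ℕ := lam.toFun.sum fun _ k => k
end Ptn

/-- `HStrip μ λ` means `μ ≺ λ`, i.e. `λ/μ` is a horizontal strip:
`λ_i ≥ μ_i ≥ λ_{i+1}` for all `i`. -/
def HStrip (mu lam : Ptn) : Prop :=
  ∀ i : ℕ, mu.part i ≤ lam.part i ∧ lam.part (i + 1) ≤ mu.part i
/-- Chains of partitions `μ = c 0 ≺ c 1 ≺ ⋯` stabilizing at `λ`; these encode
semistandard Young tableaux of shape `λ/μ` with entries in `{0, 1, 2, …}`. -/
def IsSchurChain (mu lam : Ptn) (c : ℕ → Ptn) : Prop :=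
  c 0 = mu ∧ (∀ i, HStrip (c i) (c (i + 1))) ∧ ∃ N, ∀ i, N ≤ i → c i = lam

/-- the monomial attached to a chain: the variable `X i` records the cells added
at step `i` of the chain -/
noncomputable def chainWeight {R : Type*} [CommRing R] (X : ℕ → R) (c : ℕ → Ptn) : R :=
  ∏ᶠ i : ℕ, X i ^ ((c (i + 1)).size - (c i).size)

/-- the skew Schur function `s_{λ/μ}(X)` (which is `0` if `μ ⊄ λ`) -/
noncomputable def skewSchur {R : Type*} [CommRing R] [TopologicalSpace R]
    (X : ℕ → R) (lam mu : Ptn) : R :=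
  ∑' c : {c : ℕ → Ptn // IsSchurChain mu lam c}, chainWeight X c.1

/-- `Ψ(X,Y) = ∏_{i,j} (1 - x_i y_j)⁻¹` -/
noncomputable def Psi {R : Type*} [CommRing R] [TopologicalSpace R] [Inv R] (X Y : ℕ → R) : R :=
  ∏' p : ℕ × ℕ, (1 - X p.1 * Y p.2)⁻¹

/-- `Φ(X) = ∏_i (1 - x_i)⁻¹ ∏_{i<j} (1 - x_i x_j)⁻¹` -/
noncomputable def Phi {R : Type*} [CommRing R] [TopologicalSpace R] [Inv R] (X : ℕ → R) : R :=
  (∏' i : ℕ, (1 - X i)⁻¹) * ∏' p : {q : ℕ × ℕ // q.1 < q.2}, (1 - X p.1.1 * X p.1.2)⁻¹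
/-- the coefficientwise (product) topology on multivariate formal power series -/
instance (σ : Type*) : TopologicalSpace (MvPowerSeries σ ℚ) :=
  inferInstanceAs (TopologicalSpace ((σ →₀ ℕ) → ℚ))

/-- the ambient ring: formal power series in the independent variables
`x_0, x_1, …` and `z` -/
abbrev R3 : Type := MvPowerSeries (ℕ ⊕ Unit) ℚ

/-- the alphabet `X = {x_0, x_1, …}` -/
noncomputable def Xa (n : ℕ) : R3 := MvPowerSeries.X (Sum.inl n)

/-- the extra formal variable `z` -/
noncomputable def z : R3 := MvPowerSeries.X (Sum.inr ())

namespace SchurSum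

open MvPowerSeries Finset

/-! ### Topology and truncation -/

instance : IsTopologicalRing R3 :=
  MvPowerSeries.WithPiTopology.instIsTopologicalRing (σ := ℕ ⊕ Unit) (R := ℚ)

instance : T2Space R3 :=
  MvPowerSeries.WithPiTopology.instT2Space (σ := ℕ ⊕ Unit) (R := ℚ)

theorem continuous_coeff (m : ℕ ⊕ Unit →₀ ℕ) : Continuous fun f : R3 => coeff m f :=
  MvPowerSeries.WithPiTopology.continuous_coeff ℚ m

/-- The power series all of whose coefficients at monomials dividing `m` vanish. -/
def truncIdeal (m : ℕ ⊕ Unit →₀ ℕ) : Ideal R3 where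
  carrier := {f | ∀ d ≤ m, coeff d f = 0}
  add_mem' {a b} ha hb d hd := by rw [map_add, ha d hd, hb d hd, add_zero]
  zero_mem' d _ := by simp
  smul_mem' c f hf d hd := by
    classical
    rw [smul_eq_mul, coeff_mul]
    refine Finset.sum_eq_zero fun p hp => ?_
    rw [hf p.2 ((le_of_le_of_eq le_add_self (HasAntidiagonal.mem_antidiagonal.mp hp)).trans hd), mul_zero]

/-- Truncation of a power series to the monomials dividing `m`. -/
noncomputable def tr (m : ℕ ⊕ Unit →₀ ℕ) : R3 →+* R3 ⧸ truncIdeal m :=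
  Ideal.Quotient.mk _

theorem tr_eq_tr {m : ℕ ⊕ Unit →₀ ℕ} {a b : R3} :
    tr m a = tr m b ↔ ∀ d ≤ m, coeff d a = coeff d b := by
  rw [tr, Ideal.Quotient.eq]
  change (∀ d ≤ m, coeff d (a - b) = 0) ↔ _
  simp only [map_sub, sub_eq_zero]

theorem tr_eq_zero {m : ℕ ⊕ Unit →₀ ℕ} {a : R3} :
    tr m a = 0 ↔ ∀ d ≤ m, coeff d a = 0 := by
  rw [← map_zero (tr m), tr_eq_tr]; simp

theorem tr_mono {m d : ℕ ⊕ Unit →₀ ℕ} (h : d ≤ m) {a b : R3} (hab : tr m a = tr m b) :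
    tr d a = tr d b :=
  tr_eq_tr.mpr fun e he => tr_eq_tr.mp hab e (he.trans h)

theorem coeff_eq_of_tr {m : ℕ ⊕ Unit →₀ ℕ} {a b : R3} (hab : tr m a = tr m b) :
    coeff m a = coeff m b := tr_eq_tr.mp hab m le_rfl

theorem eq_of_tr {a b : R3} (h : ∀ m, tr m a = tr m b) : a = b :=
  MvPowerSeries.ext fun m => coeff_eq_of_tr (h m)

theorem tr_pow_eq_zero {m : ℕ ⊕ Unit →₀ ℕ} {x : R3} (hx : constantCoeff x = 0) {k : ℕ}
    (hk : m.degree < k) : tr m (x ^ k) = 0 := by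
  refine tr_eq_zero.mpr fun d hd => coeff_of_lt_order ?_
  have h1 : (1 : ℕ∞) ≤ x.order := by
    rw [one_le_order_iff_constCoeff_eq_zero]; exact hx
  have h2 : d.degree ≤ m.degree := Finsupp.degree_mono hd
  calc (d.degree : ℕ∞) < k := by exact_mod_cast h2.trans_lt hk
    _ = k • (1 : ℕ∞) := by simp
    _ ≤ k • x.order := nsmul_le_nsmul_right h1 k
    _ ≤ _ := le_order_pow k

theorem tr_X_eq_zero {m : ℕ ⊕ Unit →₀ ℕ} {s : ℕ ⊕ Unit} {k : ℕ} (h : m s < k) :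
    tr m (X s ^ k) = 0 := by
  classical
  refine tr_eq_zero.mpr fun d hd => ?_
  rw [coeff_X_pow, if_neg]
  rintro rfl
  have := hd s
  simp only [Finsupp.single_eq_same] at this
  omega

theorem tr_inv_one_sub {m : ℕ ⊕ Unit →₀ ℕ} {t : R3} (ht : constantCoeff t = 0)
    (h : tr m t = 0) : tr m (1 - t)⁻¹ = 1 := by
  have h1 : (1 - t)⁻¹ * (1 - t) = 1 := MvPowerSeries.inv_mul_cancel _ (by simp [ht])
  have := congrArg (tr m) h1
  simpa [h] using this

theorem summable_of_tr {ι : Type*} {f : ι → R3}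
    (h : ∀ m, ∃ s : Set ι, s.Finite ∧ ∀ i ∉ s, tr m (f i) = 0) : Summable f := by
  refine Pi.summable.mpr fun m => summable_of_hasFiniteSupport ?_
  obtain ⟨s, hs, hf⟩ := h m
  refine hs.subset fun i hi => ?_
  by_contra his
  exact hi (tr_eq_zero.mp (hf i his) m le_rfl)

theorem coeff_tsum {ι : Type*} {f : ι → R3} (hf : Summable f) (m : ℕ ⊕ Unit →₀ ℕ) :
    coeff m (∑' i, f i) = ∑' i, coeff m (f i) :=
  hf.map_tsum (coeff m).toAddMonoidHom (continuous_coeff m)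

theorem tr_tsum {ι : Type*} {f : ι → R3} (hf : Summable f) {m : ℕ ⊕ Unit →₀ ℕ}
    (s : Finset ι) (hs : ∀ i ∉ s, tr m (f i) = 0) :
    tr m (∑' i, f i) = ∑ i ∈ s, tr m (f i) := by
  rw [← map_sum, tr_eq_tr]
  intro d hd
  rw [coeff_tsum hf, map_sum]
  exact tsum_eq_sum fun i hi => tr_eq_zero.mp (hs i hi) d hd

theorem tr_prod_eq {ι : Type*} {f : ι → R3} {m : ℕ ⊕ Unit →₀ ℕ} {s t : Finset ι}
    (hs : ∀ i ∉ s, tr m (f i) = 1) (ht : ∀ i ∉ t, tr m (f i) = 1) :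
    tr m (∏ i ∈ s, f i) = tr m (∏ i ∈ t, f i) := by
  classical
  rw [map_prod, map_prod, Finset.prod_subset (subset_union_left (s₂ := t)) fun i _ hi => hs i hi,
    Finset.prod_subset (subset_union_right (s₁ := s)) fun i _ hi => ht i hi]

theorem tr_tprod {ι : Type*} {f : ι → R3}
    (hf : ∀ m, ∃ s : Finset ι, ∀ i ∉ s, tr m (f i) = 1) {m : ℕ ⊕ Unit →₀ ℕ}
    (s : Finset ι) (hs : ∀ i ∉ s, tr m (f i) = 1) :
    tr m (∏' i, f i) = ∏ i ∈ s, tr m (f i) := by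
  choose b hb using hf
  let P : R3 := fun m => coeff m (∏ i ∈ b m, f i)
  have hP : HasProd f P := by
    refine tendsto_pi_nhds.mpr fun m => tendsto_const_nhds.congr' ?_
    filter_upwards [Filter.eventually_ge_atTop (b m)] with t ht
    exact coeff_eq_of_tr (tr_prod_eq (hb m) fun i hi => hb m i fun h => hi (ht h))
  rw [hP.tprod_eq, ← map_prod, tr_eq_tr]
  intro d hd
  change coeff d (∏ i ∈ b d, f i) = _
  refine coeff_eq_of_tr (tr_prod_eq (hb d) fun i hi => ?_)
  rw [← map_one (tr d)]
  exact tr_mono hd (by rw [hs i hi, map_one])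

theorem tsum_pow_eq_inv {t : R3} (ht : constantCoeff t = 0) : ∑' a : ℕ, t ^ a = (1 - t)⁻¹ := by
  rw [MvPowerSeries.eq_inv_iff_mul_eq_one (by simp [ht])]
  exact MvPowerSeries.WithPiTopology.tsum_pow_mul_one_sub_of_constantCoeff_eq_zero ht

theorem summable_pow {t : R3} (ht : constantCoeff t = 0) : Summable fun a : ℕ => t ^ a :=
  MvPowerSeries.WithPiTopology.summable_pow_of_constantCoeff_eq_zero ht

/-! ### Partitions -/

theorem Ptn_ext {lam mu : Ptn} (h : ∀ i, lam.part i = mu.part i) : lam = mu := by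
  obtain ⟨f, _⟩ := lam
  obtain ⟨g, _⟩ := mu
  obtain rfl : f = g := Finsupp.ext h
  rfl

theorem part_antitone (lam : Ptn) {i j : ℕ} (h : i ≤ j) : lam.part j ≤ lam.part i :=
  lam.antitone' h

theorem size_eq_sum {lam : Ptn} {N : ℕ} (h : ∀ i, N ≤ i → lam.part i = 0) :
    lam.size = ∑ i ∈ range N, lam.part i := by
  refine Finsupp.sum_of_support_subset _ (fun i hi => ?_) _ fun _ _ => rfl
  by_contra hN
  exact Finsupp.mem_support_iff.mp hi (h i (by simpa using hN))

theorem exists_bound (lam : Ptn) : ∃ N, ∀ i, N ≤ i → lam.part i = 0 := by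
  refine ⟨lam.toFun.support.sup id + 1, fun i hi => ?_⟩
  by_contra h
  have := Finset.le_sup (f := id) (Finsupp.mem_support_iff.mpr h)
  simp only [id] at this
  omega

theorem exists_bound₂ (lam mu : Ptn) :
    ∃ N, (∀ i, N ≤ i → lam.part i = 0) ∧ ∀ i, N ≤ i → mu.part i = 0 := by
  obtain ⟨N, hN⟩ := exists_bound lam
  obtain ⟨M, hM⟩ := exists_bound mu
  exact ⟨max N M, fun i hi => hN i (by omega), fun i hi => hM i (by omega)⟩

/-- The partition with a given sequence of parts. -/
noncomputable def ofSeq (f : ℕ → ℕ) (hf : Antitone f) (h : ∃ N, ∀ i, N ≤ i → f i = 0) : Ptn where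
  toFun := Finsupp.ofSupportFinite f <| by
    obtain ⟨N, hN⟩ := h
    refine (Set.finite_Iio N).subset fun i hi => ?_
    by_contra hi'
    exact hi (hN i (by simpa using hi'))
  antitone' _ _ hij := hf hij

@[simp]
theorem part_ofSeq (f : ℕ → ℕ) (hf : Antitone f) (h : ∃ N, ∀ i, N ≤ i → f i = 0) (i : ℕ) :
    (ofSeq f hf h).part i = f i := rfl

theorem part_eq_zero_of_size_le {lam : Ptn} {N i : ℕ} (h : lam.size ≤ N) (hi : N ≤ i) :
    lam.part i = 0 := by
  obtain ⟨M, hM⟩ := exists_bound lam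
  by_contra h0
  have hiM : i < M := by
    by_contra hiM
    exact h0 (hM i (by omega))
  have h1 : ∑ j ∈ range (i + 1), 1 ≤ ∑ j ∈ range M, lam.part j :=
    (Finset.sum_le_sum fun j hj => (Nat.one_le_iff_ne_zero.mpr h0).trans
      (part_antitone lam (by simp at hj; omega))).trans
      (Finset.sum_le_sum_of_subset (range_subset_range.mpr (by omega)))
  rw [← size_eq_sum hM] at h1
  simp at h1
  omega

theorem finite_size_le (N : ℕ) : {lam : Ptn | lam.size ≤ N}.Finite := by
  refine Set.Finite.of_finite_image (f := Ptn.toFun) ((Set.finite_Iic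
    (Finsupp.onFinset (range N) (fun i => if i < N then N else 0) (by simp; omega))).subset ?_)
    fun a _ b _ h => Ptn_ext fun i => DFunLike.congr_fun h i
  rintro _ ⟨lam, hlam, rfl⟩ i
  have hs : lam.size ≤ N := hlam
  simp only [Finsupp.onFinset_apply]
  split_ifs with hi
  · obtain ⟨M, hM⟩ := exists_bound lam
    refine le_trans ?_ hs
    by_cases hiM : i < M
    · rw [size_eq_sum hM]
      exact Finset.single_le_sum (f := lam.part) (fun _ _ => Nat.zero_le _) (mem_range.mpr hiM)
    · exact (hM i (by omega)).le.trans (Nat.zero_le _)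
  · exact (part_eq_zero_of_size_le hs (by omega)).le

theorem size_le_of_HStrip {mu lam : Ptn} (h : HStrip mu lam) : mu.size ≤ lam.size := by
  obtain ⟨N, h1, h2⟩ := exists_bound₂ mu lam
  rw [size_eq_sum h1, size_eq_sum h2]
  exact Finset.sum_le_sum fun i _ => (h i).1

theorem eq_of_HStrip_of_size_le {mu lam : Ptn} (h : HStrip mu lam) (hs : lam.size ≤ mu.size) :
    mu = lam := by
  obtain ⟨N, h1, h2⟩ := exists_bound₂ mu lam
  have he : mu.size = lam.size := le_antisymm (size_le_of_HStrip h) hs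
  rw [size_eq_sum h1, size_eq_sum h2, Finset.sum_eq_sum_iff_of_le fun i _ => (h i).1] at he
  refine Ptn_ext fun i => ?_
  by_cases hi : i < N
  · exact he i (mem_range.mpr hi)
  · rw [h1 i (by omega), h2 i (by omega)]

theorem HStrip_refl (lam : Ptn) : HStrip lam lam :=
  fun i => ⟨le_rfl, part_antitone lam (Nat.le_succ i)⟩

/-- The reflection `κ_i ↦ μ_{i+1} = max(τ_{i+1}, ν_{i+1}) + min(τ_i, ν_i) - κ_i`, together with a
free first part, matches common lower neighbours with common upper neighbours. -/
noncomputable def reflectEquiv (tau nu : Ptn) :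
    ℕ × {kap : Ptn // HStrip kap tau ∧ HStrip kap nu} ≃
      {mu : Ptn // HStrip tau mu ∧ HStrip nu mu} where
  toFun p := ⟨ofSeq (fun i => match i with
      | 0 => max (tau.part 0) (nu.part 0) + p.1
      | i + 1 => max (tau.part (i + 1)) (nu.part (i + 1)) + min (tau.part i) (nu.part i)
          - p.2.1.part i)
      (antitone_nat_of_succ_le fun i => by
        have h1 := fun i => p.2.2.1 i
        have h2 := fun i => p.2.2.2 i
        cases i with
        | zero => have := h1 0; have := h2 0; simp only; omega
        | succ i =>
          have := h1 i; have := h2 i; have := h1 (i + 1); have := h2 (i + 1)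
          simp only; omega)
      (by
        obtain ⟨N, hN, hN'⟩ := exists_bound₂ tau nu
        refine ⟨N + 1, fun i hi => ?_⟩
        obtain ⟨i, rfl⟩ : ∃ j, i = j + 1 := ⟨i - 1, by omega⟩
        have := hN i (by omega); have := hN' i (by omega)
        have := hN (i + 1) (by omega); have := hN' (i + 1) (by omega)
        simp only; omega),
    by
      have h1 := fun i => p.2.2.1 i
      have h2 := fun i => p.2.2.2 i
      constructor <;> intro i <;> simp only [part_ofSeq] <;> cases i with
      | zero => have := h1 0; have := h2 0; simp only; omega
      | succ i =>
        have := h1 i; have := h2 i; have := h1 (i + 1); have := h2 (i + 1)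
        simp only; omega⟩
  invFun q := ⟨q.1.part 0 - max (tau.part 0) (nu.part 0),
    ⟨ofSeq (fun i => max (tau.part (i + 1)) (nu.part (i + 1)) + min (tau.part i) (nu.part i)
          - q.1.part (i + 1))
      (antitone_nat_of_succ_le fun i => by
        have := q.2.1 i; have := q.2.2 i; have := q.2.1 (i + 1); have := q.2.2 (i + 1)
        have := q.2.1 (i + 1 + 1); have := q.2.2 (i + 1 + 1)
        omega)
      (by
        obtain ⟨N, hN, hN'⟩ := exists_bound₂ tau nu
        refine ⟨N, fun i hi => ?_⟩
        have := hN i (by omega); have := hN' i (by omega)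
        have := hN (i + 1) (by omega); have := hN' (i + 1) (by omega)
        omega),
    by
      constructor <;> intro i <;> simp only [part_ofSeq] <;>
      · have := q.2.1 i; have := q.2.2 i; have := q.2.1 (i + 1); have := q.2.2 (i + 1)
        omega⟩⟩
  left_inv p := by
    refine Prod.ext ?_ (Subtype.ext (Ptn_ext fun i => ?_))
    · simp
    · have := p.2.2.1 i; have := p.2.2.2 i
      simp only [part_ofSeq]; omega
  right_inv q := by
    refine Subtype.ext (Ptn_ext fun i => ?_)
    cases i with
    | zero => have := q.2.1 0; have := q.2.2 0; simp only [part_ofSeq]; omega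
    | succ i =>
      have := q.2.1 i; have := q.2.2 i; have := q.2.1 (i + 1); have := q.2.2 (i + 1)
      simp only [part_ofSeq]; omega

theorem size_reflectEquiv (tau nu : Ptn) (p : ℕ × {kap : Ptn // HStrip kap tau ∧ HStrip kap nu}) :
    (reflectEquiv tau nu p).1.size + p.2.1.size = p.1 + tau.size + nu.size := by
  obtain ⟨N, hN, hN'⟩ := exists_bound₂ tau nu
  have hk : ∀ i, N ≤ i → p.2.1.part i = 0 := fun i hi => by
    have := hN i hi; have := p.2.2.1 i; omega
  have hm : ∀ i, N + 1 ≤ i → (reflectEquiv tau nu p).1.part i = 0 := fun i hi => by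
    obtain ⟨i, rfl⟩ : ∃ j, i = j + 1 := ⟨i - 1, by omega⟩
    have := hN i (by omega)
    have := ((reflectEquiv tau nu p).2.1 i).2; omega
  have hs : (∑ i ∈ range N, (reflectEquiv tau nu p).1.part (i + 1)) + ∑ i ∈ range N, p.2.1.part i =
      ∑ i ∈ range N, max (tau.part (i + 1)) (nu.part (i + 1)) +
        ∑ i ∈ range N, min (tau.part i) (nu.part i) := by
    rw [← Finset.sum_add_distrib, ← Finset.sum_add_distrib]
    refine Finset.sum_congr rfl fun i _ => ?_
    have h1 := p.2.2.1 i
    have h2 := p.2.2.2 i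
    have : (reflectEquiv tau nu p).1.part (i + 1) = max (tau.part (i + 1)) (nu.part (i + 1)) +
      min (tau.part i) (nu.part i) - p.2.1.part i := rfl
    omega
  have h0 : (reflectEquiv tau nu p).1.part 0 = max (tau.part 0) (nu.part 0) + p.1 := rfl
  have hmax := Finset.sum_range_succ' (fun i => max (tau.part i) (nu.part i)) N
  rw [Finset.sum_range_succ, hN N le_rfl, hN' N le_rfl, max_self, add_zero] at hmax
  have hmm : ∑ i ∈ range N, max (tau.part i) (nu.part i) +
      ∑ i ∈ range N, min (tau.part i) (nu.part i) =
      ∑ i ∈ range N, tau.part i + ∑ i ∈ range N, nu.part i := by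
    rw [← Finset.sum_add_distrib, ← Finset.sum_add_distrib]
    exact Finset.sum_congr rfl fun i _ => max_add_min _ _
  rw [size_eq_sum hm, size_eq_sum hk, size_eq_sum hN, size_eq_sum hN', Finset.sum_range_succ']
  omega

theorem summable_of_size {f : Ptn → R3}
    (h : ∀ m, ∃ N, ∀ a, N < a.size → tr m (f a) = 0) : Summable f :=
  summable_of_tr fun m => by
    obtain ⟨N, hN⟩ := h m
    exact ⟨_, finite_size_le N, fun a ha => hN a (by simpa using ha)⟩

theorem tsum_comm_of_size {f : Ptn → Ptn → R3}
    (h : ∀ m, ∃ N, ∀ a b, N < a.size ∨ N < b.size → tr m (f a b) = 0) :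
    ∑' a, ∑' b, f a b = ∑' b, ∑' a, f a b := by
  have hf : Summable (Function.uncurry f) := summable_of_tr fun m => by
    obtain ⟨N, hN⟩ := h m
    refine ⟨_, (finite_size_le N).prod (finite_size_le N), fun p hp => hN p.1 p.2 ?_⟩
    by_contra! h'
    exact hp ⟨h'.1, h'.2⟩
  refine (hf.tsum_comm' (fun a => summable_of_size fun m => ?_)
    (fun b => summable_of_size fun m => ?_)).symm
  · exact (h m).imp fun N hN b hb => hN a b (Or.inr hb)
  · exact (h m).imp fun N hN a ha => hN a b (Or.inl ha)

/-! ### Transfer operators adding and removing horizontal strips -/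

open Classical in
/-- The one-variable skew Schur function `s_{λ/μ}(x)`. -/
noncomputable def strip (x : R3) (mu lam : Ptn) : R3 :=
  if HStrip mu lam then x ^ (lam.size - mu.size) else 0

theorem strip_eq_zero {x : R3} {mu lam : Ptn} (h : ¬ HStrip mu lam) : strip x mu lam = 0 :=
  if_neg h

theorem strip_of_HStrip {x : R3} {mu lam : Ptn} (h : HStrip mu lam) :
    strip x mu lam = x ^ (lam.size - mu.size) := if_pos h

theorem strip_eq_zero_of_size_lt {x : R3} {mu lam : Ptn} (h : lam.size < mu.size) :
    strip x mu lam = 0 :=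
  strip_eq_zero fun h' => (size_le_of_HStrip h').not_gt h

theorem tr_strip_eq_zero {x : R3} (hx : constantCoeff x = 0) {m : ℕ ⊕ Unit →₀ ℕ}
    {mu lam : Ptn} (h : mu.size + m.degree < lam.size) : tr m (strip x mu lam) = 0 := by
  by_cases hs : HStrip mu lam
  · rw [strip_of_HStrip hs, tr_pow_eq_zero hx (by omega)]
  · rw [strip_eq_zero hs, map_zero]

/-- Add a horizontal strip. -/
noncomputable def raise (x : R3) (f : Ptn → R3) (tau : Ptn) : R3 := ∑' mu, strip x tau mu * f mu

/-- Remove a horizontal strip. -/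
noncomputable def lower (x : R3) (g : Ptn → R3) (mu : Ptn) : R3 := ∑' nu, strip x nu mu * g nu

theorem summable_raise {x : R3} (hx : constantCoeff x = 0) (f : Ptn → R3) (tau : Ptn) :
    Summable fun mu => strip x tau mu * f mu :=
  summable_of_size fun m => ⟨tau.size + m.degree, fun mu h => by
    rw [map_mul, tr_strip_eq_zero hx h, zero_mul]⟩

theorem summable_lower (x : R3) (g : Ptn → R3) (mu : Ptn) :
    Summable fun nu => strip x nu mu * g nu :=
  summable_of_size fun m => ⟨mu.size, fun nu h => by
    rw [strip_eq_zero_of_size_lt h, zero_mul, map_zero]⟩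

theorem raise_smul {x : R3} (hx : constantCoeff x = 0) (c : R3) (f : Ptn → R3) :
    raise x (c • f) = c • raise x f := by
  ext1 tau
  rw [Pi.smul_apply, raise, raise, smul_eq_mul, ← (summable_raise hx f tau).tsum_mul_left]
  exact tsum_congr fun mu => by rw [Pi.smul_apply, smul_eq_mul]; ring

theorem lower_smul (x : R3) (c : R3) (g : Ptn → R3) :
    lower x (c • g) = c • lower x g := by
  ext1 mu
  rw [Pi.smul_apply, lower, lower, smul_eq_mul, ← (summable_lower x g mu).tsum_mul_left]
  exact tsum_congr fun nu => by rw [Pi.smul_apply, smul_eq_mul]; ring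

/-- The one-variable skew Cauchy identity. -/
theorem tsum_strip_mul_strip {x : R3} (hx : constantCoeff x = 0) (y : R3) (tau nu : Ptn) :
    ∑' mu, strip x tau mu * strip y nu mu =
      (1 - x * y)⁻¹ * ∑' kap, strip y kap tau * strip x kap nu := by
  have hxy : constantCoeff (x * y) = 0 := by rw [map_mul, hx, zero_mul]
  have h1 : HasSum (fun mu : {mu : Ptn // HStrip tau mu ∧ HStrip nu mu} =>
      strip x tau mu * strip y nu mu) (∑' mu, strip x tau mu * strip y nu mu) :=
    (hasSum_subtype_iff_of_support_subset fun mu hmu => by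
      by_contra hn
      rcases not_and_or.mp hn with h | h <;> exact hmu (by simp [strip_eq_zero h])).mpr
      (summable_raise hx (strip y nu) tau).hasSum
  have h2 : HasSum (fun kap : {kap : Ptn // HStrip kap tau ∧ HStrip kap nu} =>
      strip y kap tau * strip x kap nu) (∑' kap, strip y kap tau * strip x kap nu) :=
    (hasSum_subtype_iff_of_support_subset fun kap hk => by
      by_contra hn
      rcases not_and_or.mp hn with h | h <;> exact hk (by simp [strip_eq_zero h])).mpr
      (summable_lower y (fun kap => strip x kap nu) tau).hasSum
  have h3 : HasSum (fun p : ℕ × {kap : Ptn // HStrip kap tau ∧ HStrip kap nu} =>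
      (x * y) ^ p.1 * (strip y p.2 tau * strip x p.2 nu))
      (∑' mu, strip x tau mu * strip y nu mu) := by
    refine ((reflectEquiv tau nu).hasSum_iff.mpr h1).congr_fun ?_
    intro p
    obtain ⟨ha, hb⟩ := (reflectEquiv tau nu p).2
    obtain ⟨hc, hd⟩ := p.2.2
    have hs := size_reflectEquiv tau nu p
    have := size_le_of_HStrip ha
    have := size_le_of_HStrip hb
    have := size_le_of_HStrip hc
    have := size_le_of_HStrip hd
    rw [Function.comp_apply, strip_of_HStrip ha, strip_of_HStrip hb, strip_of_HStrip hc,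
      strip_of_HStrip hd,
      show (reflectEquiv tau nu p).1.size - tau.size = p.1 + (nu.size - p.2.1.size) by omega,
      show (reflectEquiv tau nu p).1.size - nu.size = p.1 + (tau.size - p.2.1.size) by omega]
    ring
  have h4 : HasSum (fun a : ℕ => (x * y) ^ a) (1 - x * y)⁻¹ :=
    tsum_pow_eq_inv hxy ▸ (summable_pow hxy).hasSum
  have h5 := HasSum.mul h4 h2 h3.summable
  exact h3.unique h5

theorem raise_one {x : R3} (hx : constantCoeff x = 0) :
    raise x 1 = (1 - x)⁻¹ • lower x 1 := by
  ext1 tau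
  have h := tsum_strip_mul_strip hx 1 tau tau
  rw [mul_one] at h
  have h1 : ∀ a b, strip x a b * strip 1 a b = strip x a b := fun a b => by
    by_cases hs : HStrip a b
    · rw [strip_of_HStrip (x := 1) hs, one_pow, mul_one]
    · rw [strip_eq_zero hs, zero_mul]
  simp only [mul_comm (strip 1 _ _), h1] at h
  simpa [raise, lower] using h

theorem raise_lower {x : R3} (hx : constantCoeff x = 0) (y : R3) (g : Ptn → R3) :
    raise x (lower y g) = (1 - x * y)⁻¹ • lower y (raise x g) := by
  ext1 tau
  have h1 : ∑' mu, ∑' nu, strip x tau mu * (strip y nu mu * g nu) =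
      ∑' nu, ∑' mu, strip x tau mu * (strip y nu mu * g nu) :=
    tsum_comm_of_size fun m => ⟨tau.size + m.degree, fun mu nu h => by
      by_cases hmu : tau.size + m.degree < mu.size
      · rw [map_mul, tr_strip_eq_zero hx hmu, zero_mul]
      · rw [strip_eq_zero_of_size_lt (x := y) (mu := nu) (lam := mu) (by omega), zero_mul,
          mul_zero, map_zero]⟩
  have h2 : ∑' kap, ∑' nu, (1 - x * y)⁻¹ * (strip y kap tau * (strip x kap nu * g nu)) =
      ∑' nu, ∑' kap, (1 - x * y)⁻¹ * (strip y kap tau * (strip x kap nu * g nu)) :=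
    tsum_comm_of_size fun m => ⟨tau.size + m.degree, fun kap nu h => by
      by_cases hk : tau.size < kap.size
      · rw [strip_eq_zero_of_size_lt hk, zero_mul, mul_zero, map_zero]
      · rw [map_mul, map_mul, map_mul, tr_strip_eq_zero hx (mu := kap) (lam := nu) (by omega),
          zero_mul, mul_zero, mul_zero]⟩
  have hs : ∀ nu, Summable fun mu => strip x tau mu * strip y nu mu :=
    fun nu => summable_raise hx (strip y nu) tau
  have hs' : ∀ nu, Summable fun kap => strip y kap tau * strip x kap nu :=
    fun nu => summable_lower y (fun kap => strip x kap nu) tau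
  calc raise x (lower y g) tau
      = ∑' mu, ∑' nu, strip x tau mu * (strip y nu mu * g nu) :=
        tsum_congr fun mu => ((summable_lower y g mu).tsum_mul_left _).symm
    _ = ∑' nu, ∑' mu, strip x tau mu * (strip y nu mu * g nu) := h1
    _ = ∑' nu, ∑' kap, (1 - x * y)⁻¹ * (strip y kap tau * (strip x kap nu * g nu)) :=
        tsum_congr fun nu => by
          simp only [← mul_assoc]
          rw [(hs nu).tsum_mul_right, tsum_strip_mul_strip hx, ← (hs' nu).tsum_mul_left,
            ← ((hs' nu).mul_left _).tsum_mul_right]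
          simp only [mul_assoc]
    _ = ∑' kap, ∑' nu, (1 - x * y)⁻¹ * (strip y kap tau * (strip x kap nu * g nu)) := h2.symm
    _ = ∑' kap, (1 - x * y)⁻¹ * (strip y kap tau * raise x g kap) :=
        tsum_congr fun kap => by
          rw [((summable_raise hx g kap).mul_left _).tsum_mul_left,
            (summable_raise hx g kap).tsum_mul_left, raise]
    _ = ((1 - x * y)⁻¹ • lower y (raise x g)) tau :=
        (summable_lower y (raise x g) tau).tsum_mul_left _

/-- Iterated `raise`, in the variables `x 0, …, x (n - 1)`. -/
noncomputable def raiseIter (x : ℕ → R3) : ℕ → (Ptn → R3) → Ptn → R3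
  | 0, f => f
  | n + 1, f => raiseIter x n (raise (x n) f)

/-- Iterated `lower` applied to `1`, i.e. `μ ↦ ∑_τ s_{μ/τ}(x 0, …, x (n - 1))`. -/
noncomputable def lowerIter (x : ℕ → R3) : ℕ → Ptn → R3
  | 0 => 1
  | n + 1 => lower (x n) (lowerIter x n)

/-- The finite-alphabet version of `Phi`. -/
noncomputable def phiFin (x : ℕ → R3) (n : ℕ) : R3 :=
  ∏ i ∈ range n, ((1 - x i)⁻¹ * ∏ j ∈ range i, (1 - x j * x i)⁻¹)

theorem raiseIter_smul {x : ℕ → R3} (hx : ∀ i, constantCoeff (x i) = 0) (n : ℕ) (c : R3)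
    (f : Ptn → R3) : raiseIter x n (c • f) = c • raiseIter x n f := by
  induction n generalizing f with
  | zero => rfl
  | succ n ih => rw [raiseIter, raise_smul (hx n), ih, raiseIter]

theorem raiseIter_lower {x : ℕ → R3} (hx : ∀ i, constantCoeff (x i) = 0) (n : ℕ) (y : R3)
    (g : Ptn → R3) : raiseIter x n (lower y g) =
      (∏ j ∈ range n, (1 - x j * y)⁻¹) • lower y (raiseIter x n g) := by
  induction n generalizing g with
  | zero => simp [raiseIter]
  | succ n ih =>
    rw [raiseIter, raise_lower (hx n), raiseIter_smul hx, ih, raiseIter, prod_range_succ,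
      smul_smul, mul_comm]

/-- `∑_μ s_{μ/τ} = Φ ∑_ν s_{τ/ν}` for finitely many variables. -/
theorem raiseIter_one {x : ℕ → R3} (hx : ∀ i, constantCoeff (x i) = 0) (n : ℕ) :
    raiseIter x n 1 = phiFin x n • lowerIter x n := by
  induction n with
  | zero => simp [raiseIter, phiFin, lowerIter]
  | succ n ih =>
    rw [raiseIter, raise_one (hx n), raiseIter_smul hx, raiseIter_lower hx, ih, lower_smul,
      smul_smul, smul_smul, phiFin, phiFin, prod_range_succ, lowerIter]
    congr 1
    ring

/-! ### The functional equation -/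

theorem constantCoeff_z : constantCoeff z = 0 := constantCoeff_X _

theorem tr_z_pow_eq_zero {m : ℕ ⊕ Unit →₀ ℕ} {k : ℕ} (h : m (Sum.inr ()) < k) :
    tr m (z ^ k) = 0 := tr_X_eq_zero h

/-- The pairing `∑_μ z^{|μ|} h(μ) g(μ)`. -/
noncomputable def pairing (h g : Ptn → R3) : R3 := ∑' mu : Ptn, z ^ mu.size * (h mu * g mu)

theorem summable_pairing (h g : Ptn → R3) :
    Summable fun mu : Ptn => z ^ mu.size * (h mu * g mu) :=
  summable_of_size fun m => ⟨m (Sum.inr ()), fun mu hm => by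
    rw [map_mul, tr_z_pow_eq_zero hm, zero_mul]⟩

theorem pairing_smul_left (c : R3) (h g : Ptn → R3) :
    pairing (c • h) g = c * pairing h g := by
  rw [pairing, pairing, ← (summable_pairing h g).tsum_mul_left]
  exact tsum_congr fun mu => by rw [Pi.smul_apply, smul_eq_mul]; ring

theorem pairing_comm (h g : Ptn → R3) : pairing h g = pairing g h :=
  tsum_congr fun mu => by rw [mul_comm (h mu)]

theorem pairing_lower (x : R3) (h g : Ptn → R3) :
    pairing h (lower x g) = pairing (raise (z * x) h) g := by
  have hzx : constantCoeff (z * x) = 0 := by rw [map_mul, constantCoeff_z, zero_mul]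
  have hs : ∑' mu : Ptn, ∑' nu, z ^ mu.size * h mu * (strip x nu mu * g nu) =
      ∑' nu, ∑' mu : Ptn, z ^ mu.size * h mu * (strip x nu mu * g nu) :=
    tsum_comm_of_size fun m => ⟨m (Sum.inr ()), fun mu nu hN => by
      by_cases hmu : m (Sum.inr ()) < mu.size
      · rw [map_mul, map_mul, tr_z_pow_eq_zero hmu, zero_mul, zero_mul]
      · rw [strip_eq_zero_of_size_lt (x := x) (mu := nu) (lam := mu) (by omega), zero_mul,
          mul_zero, map_zero]⟩
  calc pairing h (lower x g)
      = ∑' mu : Ptn, ∑' nu, z ^ mu.size * h mu * (strip x nu mu * g nu) :=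
        tsum_congr fun mu => by rw [(summable_lower x g mu).tsum_mul_left, mul_assoc]; rfl
    _ = ∑' nu, ∑' mu : Ptn, z ^ mu.size * h mu * (strip x nu mu * g nu) := hs
    _ = pairing (raise (z * x) h) g := tsum_congr fun nu => by
        rw [raise, ← (summable_raise hzx h nu).tsum_mul_right,
          ← ((summable_raise hzx h nu).mul_right _).tsum_mul_left]
        refine tsum_congr fun mu => ?_
        by_cases hst : HStrip nu mu
        · rw [strip_of_HStrip hst, strip_of_HStrip hst]
          nth_rewrite 1 [← Nat.add_sub_cancel' (size_le_of_HStrip hst)]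
          ring
        · simp [strip_eq_zero hst]

theorem pairing_lowerIter (x : ℕ → R3) (n : ℕ) (h : Ptn → R3) :
    pairing h (lowerIter x n) = pairing (raiseIter (fun i => z * x i) n h) 1 := by
  induction n generalizing h with
  | zero => rfl
  | succ n ih => rw [lowerIter, pairing_lower, ih, raiseIter]

/-- The generating function of pairs of partitions, for a finite alphabet. -/
noncomputable def genFin (x : ℕ → R3) (n : ℕ) : R3 := pairing 1 (lowerIter x n)

theorem genFin_eq (x : ℕ → R3) (n : ℕ) :
    genFin x n = phiFin (fun i => z * x i) n * genFin (fun i => z * x i) n := by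
  rw [genFin, pairing_lowerIter, raiseIter_one fun i => by rw [map_mul, constantCoeff_z, zero_mul],
    pairing_smul_left, pairing_comm, genFin]

theorem genFin_eq_prod (x : ℕ → R3) (n K : ℕ) :
    genFin x n = (∏ k ∈ range K, phiFin (fun i => z ^ (k + 1) * x i) n) *
      genFin (fun i => z ^ K * x i) n := by
  induction K with
  | zero => simp
  | succ K ih =>
    rw [ih, prod_range_succ, genFin_eq]
    simp only [← mul_assoc, pow_succ']

theorem tr_lowerIter_eq_one {m : ℕ ⊕ Unit →₀ ℕ} {x : ℕ → R3}
    (hx : ∀ i, tr m (x i) = 0) (n : ℕ) (mu : Ptn) : tr m (lowerIter x n mu) = 1 := by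
  induction n generalizing mu with
  | zero => simp [lowerIter]
  | succ n ih =>
    rw [lowerIter, lower, tr_tsum (summable_lower _ _ mu) {mu}, sum_singleton,
      strip_of_HStrip (HStrip_refl mu), map_mul, ih]
    · simp
    · intro nu hnu
      by_cases hs : HStrip nu mu
      · have hlt : mu.size - nu.size ≠ 0 := fun h0 =>
          hnu (mem_singleton.mpr (eq_of_HStrip_of_size_le hs (by omega)))
        rw [strip_of_HStrip hs, map_mul, map_pow, hx, zero_pow hlt, zero_mul]
      · rw [strip_eq_zero hs, zero_mul, map_zero]

/-! ### The generating function of partitions -/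

/-- Partitions with at most `N + 1` parts: split off the columns of height `N + 1`. -/
noncomputable def columnEquiv (N : ℕ) :
    ℕ × {mu : Ptn // mu.part N = 0} ≃ {mu : Ptn // mu.part (N + 1) = 0} where
  toFun p := ⟨ofSeq (fun i => p.2.1.part i + if i ≤ N then p.1 else 0)
      (antitone_nat_of_succ_le fun i =>
        add_le_add (part_antitone _ i.le_succ) (by split_ifs <;> omega))
      (by
        obtain ⟨M, hM⟩ := exists_bound p.2.1
        exact ⟨max M (N + 1), fun i hi => by rw [hM i (by omega), if_neg (by omega)]⟩),
    by
      have h1 := part_antitone p.2.1 (Nat.le_succ N)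
      have h2 := p.2.2
      rw [part_ofSeq, if_neg (by omega)]
      exact Nat.le_zero.mp (h1.trans h2.le)⟩
  invFun q := ⟨q.1.part N, ⟨ofSeq (fun i => q.1.part i - q.1.part N)
      (antitone_nat_of_succ_le fun i =>
        Nat.sub_le_sub_right (part_antitone _ i.le_succ) _)
      ((exists_bound q.1).imp fun M hM i hi => by rw [hM i hi, Nat.zero_sub]),
    by simp⟩⟩
  left_inv p := by
    have h := p.2.2
    refine Prod.ext (by simp [h]) (Subtype.ext (Ptn_ext fun i => ?_))
    have := fun h : N ≤ i => part_antitone p.2.1 h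
    simp only [part_ofSeq, h, le_refl, if_true]
    split_ifs <;> omega
  right_inv q := by
    refine Subtype.ext (Ptn_ext fun i => ?_)
    have h := q.2
    have h1 := fun h : i ≤ N => part_antitone q.1 h
    have h2 := fun h : N + 1 ≤ i => part_antitone q.1 h
    simp only [part_ofSeq]
    split_ifs <;> omega

theorem size_columnEquiv (N : ℕ) (p : ℕ × {mu : Ptn // mu.part N = 0}) :
    (columnEquiv N p).1.size = (N + 1) * p.1 + p.2.1.size := by
  have h1 : ∀ i, N + 1 ≤ i → (columnEquiv N p).1.part i = 0 := fun i hi => by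
    have := part_antitone (columnEquiv N p).1 hi
    have := (columnEquiv N p).2
    omega
  have h2 : ∀ i, N + 1 ≤ i → p.2.1.part i = 0 := fun i hi => by
    have := part_antitone p.2.1 (show N ≤ i by omega)
    have := p.2.2
    omega
  have h3 : ∀ i ∈ range (N + 1), (columnEquiv N p).1.part i = p.1 + p.2.1.part i :=
    fun i hi => by
      have : (columnEquiv N p).1.part i = p.2.1.part i + if i ≤ N then p.1 else 0 := rfl
      rw [this, if_pos (by simp at hi; omega), add_comm]
  rw [size_eq_sum h1, size_eq_sum h2, Finset.sum_congr rfl h3, Finset.sum_add_distrib]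
  simp

/-- The generating function of partitions with at most `N` parts. -/
noncomputable def partGen (N : ℕ) : R3 := ∑' mu : Ptn, if mu.part N = 0 then z ^ mu.size else 0

theorem summable_partGen (N : ℕ) :
    Summable fun mu : Ptn => if mu.part N = 0 then z ^ mu.size else 0 :=
  summable_of_size fun m => ⟨m (Sum.inr ()), fun mu hm => by
    split_ifs
    · exact tr_z_pow_eq_zero hm
    · exact map_zero _⟩

theorem hasSum_partGen (N : ℕ) :
    HasSum (fun mu : {mu : Ptn // mu.part N = 0} => z ^ mu.1.size) (partGen N) := by
  have h := (hasSum_subtype_iff_of_support_subset (s := {mu : Ptn | mu.part N = 0})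
    fun mu hmu => by
      by_contra hn
      exact hmu (if_neg hn)).mpr (summable_partGen N).hasSum
  exact h.congr_fun fun mu => (if_pos mu.2).symm

theorem constantCoeff_z_pow (k : ℕ) : constantCoeff (z ^ (k + 1)) = 0 := by
  rw [map_pow, constantCoeff_z, zero_pow k.succ_ne_zero]

theorem partGen_eq_prod (N : ℕ) : partGen N = ∏ k ∈ range N, (1 - z ^ (k + 1))⁻¹ := by
  induction N with
  | zero =>
    have h0 : ∀ mu : Ptn, mu.part 0 = 0 → mu.size = 0 := fun mu hmu => by
      rw [size_eq_sum (N := 0) fun i _ => Nat.le_zero.mp (hmu ▸ part_antitone mu (Nat.zero_le i)),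
        range_zero, sum_empty]
    let o : Ptn := ofSeq (fun _ => 0) antitone_const ⟨0, fun _ _ => rfl⟩
    have ho : o.part 0 = 0 := rfl
    rw [partGen, range_zero, prod_empty, tsum_eq_single o, if_pos ho, h0 o ho, pow_zero]
    intro mu hmu
    refine if_neg fun h => hmu (Ptn_ext fun i => ?_)
    exact Nat.le_zero.mp (h ▸ part_antitone mu (Nat.zero_le i))
  | succ N ih =>
    have h1 : HasSum (fun p : ℕ × {mu : Ptn // mu.part N = 0} =>
        (z ^ (N + 1)) ^ p.1 * z ^ p.2.1.size) (partGen (N + 1)) := by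
      refine ((columnEquiv N).hasSum_iff.mpr (hasSum_partGen (N + 1))).congr_fun fun p => ?_
      rw [Function.comp_apply, size_columnEquiv, pow_add z _ p.2.1.size, pow_mul]
    have h2 : HasSum (fun a : ℕ => (z ^ (N + 1)) ^ a) (1 - z ^ (N + 1))⁻¹ :=
      tsum_pow_eq_inv (constantCoeff_z_pow N) ▸ (summable_pow (constantCoeff_z_pow N)).hasSum
    have h3 := HasSum.mul h2 (hasSum_partGen N) h1.summable
    rw [h1.unique h3, prod_range_succ, ih, mul_comm]

theorem tr_genFin_z_pow {m : ℕ ⊕ Unit →₀ ℕ} {N : ℕ} (hN : m (Sum.inr ()) < N) (x : ℕ → R3)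
    (n : ℕ) : tr m (genFin (fun i => z ^ N * x i) n) = tr m (partGen N) := by
  have hz : ∀ mu ∉ (finite_size_le N).toFinset, tr m (z ^ mu.size) = 0 := fun mu hmu =>
    tr_z_pow_eq_zero (by simp at hmu; omega)
  rw [genFin, pairing, partGen, tr_tsum (summable_pairing _ _) (finite_size_le N).toFinset
    fun mu hmu => by rw [map_mul, hz mu hmu, zero_mul],
    tr_tsum (summable_partGen N) (finite_size_le N).toFinset
    fun mu hmu => by split_ifs <;> simp [hz mu hmu]]
  refine Finset.sum_congr rfl fun mu hmu => ?_
  rw [if_pos (part_eq_zero_of_size_le (by simpa using hmu) le_rfl), map_mul, map_mul,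
    tr_lowerIter_eq_one fun i => by rw [map_mul, tr_z_pow_eq_zero hN, zero_mul]]
  simp

/-! ### The product side -/

theorem exists_tr_Xa (m : ℕ ⊕ Unit →₀ ℕ) : ∃ n, ∀ i, n ≤ i → m (Sum.inl i) = 0 := by
  refine ⟨m.support.sup (Sum.elim id 0) + 1, fun i hi => ?_⟩
  by_contra h
  have := Finset.le_sup (f := Sum.elim id 0) (Finsupp.mem_support_iff.mpr h)
  simp only [Sum.elim_inl, id] at this
  omega

theorem tr_Xa_pow_eq_zero {m : ℕ ⊕ Unit →₀ ℕ} {i k : ℕ} (h : m (Sum.inl i) = 0) (hk : k ≠ 0) :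
    tr m (Xa i ^ k) = 0 := tr_X_eq_zero (by omega)

theorem tr_Phi {x : ℕ → R3} (hx : ∀ i, constantCoeff (x i) = 0)
    (hx' : ∀ m, ∃ n, ∀ i, n ≤ i → tr m (x i) = 0) {m : ℕ ⊕ Unit →₀ ℕ} {n : ℕ}
    (hn : ∀ i, n ≤ i → tr m (x i) = 0) : tr m (Phi x) = tr m (phiFin x n) := by
  have h1 : ∀ (m : ℕ ⊕ Unit →₀ ℕ) (n : ℕ), (∀ i, n ≤ i → tr m (x i) = 0) →
      ∀ i ∉ range n, tr m (1 - x i)⁻¹ = 1 := fun m n hn i hi =>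
    tr_inv_one_sub (hx i) (hn i (by simpa using hi))
  have h2 : ∀ (m : ℕ ⊕ Unit →₀ ℕ) (n : ℕ), (∀ i, n ≤ i → tr m (x i) = 0) →
      ∀ p ∉ (range n ×ˢ range n).subtype fun q : ℕ × ℕ => q.1 < q.2,
        tr m (1 - x p.1.1 * x p.1.2)⁻¹ = 1 := fun m n hn p hp =>
    tr_inv_one_sub (by rw [map_mul, hx, zero_mul]) <| by
      have h : n ≤ p.1.2 := by
        by_contra h
        exact hp (by simp only [mem_subtype, mem_product, mem_range]; have := p.2; omega)
      rw [map_mul, hn _ h, mul_zero]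
  rw [Phi, map_mul, tr_tprod (fun m => (hx' m).elim fun n hn => ⟨_, h1 m n hn⟩) _ (h1 m n hn),
    tr_tprod (fun m => (hx' m).elim fun n hn => ⟨_, h2 m n hn⟩) _ (h2 m n hn),
    Finset.prod_subtype_eq_prod_filter (f := fun p : ℕ × ℕ => tr m (1 - x p.1 * x p.2)⁻¹),
    prod_filter, prod_product_right, phiFin, map_prod, ← Finset.prod_mul_distrib]
  refine Finset.prod_congr rfl fun i hi => ?_
  rw [map_mul, map_prod, ← prod_filter]
  congr 2
  ext j
  simp only [mem_filter, mem_range] at *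
  omega

theorem tr_tprod_Phi {m : ℕ ⊕ Unit →₀ ℕ} {n N : ℕ} (hn : ∀ i, n ≤ i → m (Sum.inl i) = 0)
    (hN : m (Sum.inr ()) < N) :
    tr m (∏' k : ℕ, Phi (fun i => z ^ (k + 1) * Xa i) * (1 - z ^ (k + 1))⁻¹) =
      tr m ((∏ k ∈ range N, phiFin (fun i => z ^ (k + 1) * Xa i) n) *
        ∏ k ∈ range N, (1 - z ^ (k + 1))⁻¹) := by
  have hx : ∀ k i, constantCoeff (z ^ (k + 1) * Xa i) = 0 := fun k i => by
    rw [map_mul, constantCoeff_z_pow, zero_mul]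
  have hXa : ∀ (m : ℕ ⊕ Unit →₀ ℕ) n, (∀ i, n ≤ i → m (Sum.inl i) = 0) →
      ∀ k i, n ≤ i → tr m (z ^ (k + 1) * Xa i) = 0 := fun m n hn k i hi => by
    rw [map_mul, ← pow_one (Xa i), tr_Xa_pow_eq_zero (hn i hi) one_ne_zero, mul_zero]
  have hx' : ∀ k m, ∃ n, ∀ i, n ≤ i → tr m (z ^ (k + 1) * Xa i) = 0 := fun k m =>
    (exists_tr_Xa m).imp fun n hn => hXa m n hn k
  have h1 : ∀ (m : ℕ ⊕ Unit →₀ ℕ) N, m (Sum.inr ()) < N → ∀ k ∉ range N,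
      tr m (Phi (fun i => z ^ (k + 1) * Xa i) * (1 - z ^ (k + 1))⁻¹) = 1 := fun m N hN k hk => by
    have hz : tr m (z ^ (k + 1)) = 0 := tr_z_pow_eq_zero (by simp at hk; omega)
    rw [map_mul, tr_inv_one_sub (constantCoeff_z_pow k) hz,
      tr_Phi (hx k) (hx' k) (n := 0) fun i _ => by rw [map_mul, hz, zero_mul]]
    simp [phiFin]
  rw [tr_tprod (fun m => ⟨_, h1 m _ (Nat.lt_succ_self _)⟩) _ (h1 m N hN), ← prod_mul_distrib,
    map_prod]
  exact Finset.prod_congr rfl fun k _ => by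
    rw [map_mul, map_mul, tr_Phi (hx k) (hx' k) (hXa m n hn k)]

/-! ### The sum side -/

theorem finite_HStrip (mu : Ptn) : {nu : Ptn | HStrip nu mu}.Finite :=
  (finite_size_le mu.size).subset fun _ h => size_le_of_HStrip h

open Classical in
/-- The chains of horizontal strips which are constant, equal to `mu`, from step `n` on. -/
noncomputable def chains : ℕ → Ptn → Finset (ℕ → Ptn)
  | 0, mu => {fun _ => mu}
  | n + 1, mu => (finite_HStrip mu).toFinset.biUnion fun nu =>
      (chains n nu).image fun c i => if i ≤ n then c i else mu

theorem mem_chains {n : ℕ} {mu : Ptn} {c : ℕ → Ptn} :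
    c ∈ chains n mu ↔ (∀ i, HStrip (c i) (c (i + 1))) ∧ ∀ i, n ≤ i → c i = mu := by
  induction n generalizing mu c with
  | zero =>
    rw [chains, mem_singleton]
    constructor
    · rintro rfl
      exact ⟨fun _ => HStrip_refl mu, fun _ _ => rfl⟩
    · exact fun h => funext fun i => h.2 i (Nat.zero_le i)
  | succ n ih =>
    simp only [chains, mem_biUnion, Set.Finite.mem_toFinset, Set.mem_ofPred_eq, mem_image, ih]
    constructor
    · rintro ⟨nu, hnu, c, ⟨hc, hc'⟩, rfl⟩
      refine ⟨fun i => ?_, fun i hi => if_neg (by omega)⟩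
      rcases lt_trichotomy i n with h | rfl | h
      · simpa [h.le, Nat.succ_le_of_lt h] using hc i
      · simpa [hc' i le_rfl] using hnu
      · simpa [show ¬ i ≤ n by omega, show ¬ i + 1 ≤ n by omega] using HStrip_refl mu
    · rintro ⟨hc, hc'⟩
      refine ⟨c n, hc' (n + 1) le_rfl ▸ hc n, fun i => c (min i n), ⟨fun i => ?_, fun i hi => ?_⟩,
        funext fun i => ?_⟩
      · rcases lt_or_ge i n with h | h
        · simpa [h.le, Nat.succ_le_of_lt h] using hc i
        · simpa [h, h.trans (Nat.le_succ i)] using HStrip_refl (c n)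
      · simp [hi]
      · split_ifs with h
        · simp [h]
        · exact (hc' i (by omega)).symm

theorem sum_chains (x : ℕ → R3) (n : ℕ) (mu : Ptn) :
    ∑ c ∈ chains n mu, ∏ i ∈ range n, x i ^ ((c (i + 1)).size - (c i).size) =
      lowerIter x n mu := by
  classical
  induction n generalizing mu with
  | zero => simp [chains, lowerIter]
  | succ n ih =>
    have hd : ((finite_HStrip mu).toFinset : Set Ptn).PairwiseDisjoint fun nu =>
        (chains n nu).image fun c i => if i ≤ n then c i else mu := by
      intro nu _ nu' _ hne
      refine Finset.disjoint_left.mpr fun c hc hc' => hne ?_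
      obtain ⟨d, hd, rfl⟩ := mem_image.mp hc
      obtain ⟨d', hd', he⟩ := mem_image.mp hc'
      have := congrFun he n
      simpa [(mem_chains.mp hd).2 n le_rfl, (mem_chains.mp hd').2 n le_rfl] using this.symm
    rw [chains, sum_biUnion hd, lowerIter, lower, tsum_eq_sum (s := (finite_HStrip mu).toFinset)
      fun nu hnu => by rw [strip_eq_zero (by simpa using hnu), zero_mul]]
    refine Finset.sum_congr rfl fun nu hnu => ?_
    rw [strip_of_HStrip (by simpa using hnu), ← ih, mul_sum, sum_image]
    · refine Finset.sum_congr rfl fun c hc => ?_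
      rw [prod_range_succ, mul_comm]
      congr 1
      · simp [(mem_chains.mp hc).2 n le_rfl]
      · refine Finset.prod_congr rfl fun i hi => ?_
        have := mem_range.mp hi
        simp only [if_pos this.le, if_pos (Nat.succ_le_of_lt this)]
    · intro c hc d hd he
      funext i
      have hi := congrFun he i
      by_cases h : i ≤ n
      · simpa [h] using hi
      · rw [(mem_chains.mp hc).2 i (by omega), (mem_chains.mp hd).2 i (by omega)]

theorem chainWeight_eq_prod {R : Type*} [CommRing R] (x : ℕ → R) {n : ℕ} {mu : Ptn}
    {c : ℕ → Ptn} (h : ∀ i, n ≤ i → c i = mu) :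
    chainWeight x c = ∏ i ∈ range n, x i ^ ((c (i + 1)).size - (c i).size) := by
  refine finprod_eq_prod_of_mulSupport_subset _ fun i hi => ?_
  by_contra hin
  have hni : n ≤ i := by simpa using hin
  exact hi (by simp [h i hni, h (i + 1) (by omega)])

theorem tr_chainWeight_eq_zero {m : ℕ ⊕ Unit →₀ ℕ} {n : ℕ}
    (hn : ∀ i, n ≤ i → m (Sum.inl i) = 0) {tau mu : Ptn} {c : ℕ → Ptn}
    (hc : IsSchurChain tau mu c) (hcn : c ∉ chains n mu) : tr m (chainWeight Xa c) = 0 := by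
  obtain ⟨-, hs, N, hN⟩ := hc
  obtain ⟨i, hi, hne⟩ : ∃ i, n ≤ i ∧ c i ≠ c (i + 1) := by
    by_contra! h
    have hconst : ∀ k, c (n + k) = c n := fun k => by
      induction k with
      | zero => rfl
      | succ k ih => rw [← ih]; exact (h (n + k) (by omega)).symm
    refine hcn (mem_chains.mpr ⟨hs, fun i hi => ?_⟩)
    obtain ⟨k, rfl⟩ := Nat.exists_eq_add_of_le hi
    rw [hconst, ← hconst N, hN _ (by omega)]
  have hiN : i < N := by
    by_contra h
    exact hne (by rw [hN i (by omega), hN (i + 1) (by omega)])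
  have hsize : (c (i + 1)).size - (c i).size ≠ 0 := fun h =>
    hne (eq_of_HStrip_of_size_le (hs i) (by omega))
  rw [chainWeight_eq_prod Xa hN, map_prod]
  exact prod_eq_zero (mem_range.mpr hiN) (tr_Xa_pow_eq_zero (hn i hi) hsize)

theorem size_le_of_isSchurChain {tau mu : Ptn} {c : ℕ → Ptn} (hc : IsSchurChain tau mu c)
    (i : ℕ) : (c i).size ≤ mu.size := by
  obtain ⟨-, hs, N, hN⟩ := hc
  have hmono : Monotone fun i => (c i).size :=
    monotone_nat_of_le_succ fun i => size_le_of_HStrip (hs i)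
  exact (hmono (le_max_left i N)).trans (by simp [hN _ (le_max_right i N)])

theorem skewSchur_eq_zero {tau mu : Ptn} (h : mu.size < tau.size) : skewSchur Xa mu tau = 0 := by
  have : IsEmpty {c : ℕ → Ptn // IsSchurChain tau mu c} :=
    ⟨fun c => h.not_ge (c.2.1 ▸ size_le_of_isSchurChain c.2 0)⟩
  exact tsum_empty

open Classical in
theorem tr_skewSchur {m : ℕ ⊕ Unit →₀ ℕ} {n : ℕ} (hn : ∀ i, n ≤ i → m (Sum.inl i) = 0)
    (tau mu : Ptn) : tr m (skewSchur Xa mu tau) =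
      ∑ c ∈ chains n mu with IsSchurChain tau mu c, tr m (chainWeight Xa c) := by
  have h : ∀ (m : ℕ ⊕ Unit →₀ ℕ) n, (∀ i, n ≤ i → m (Sum.inl i) = 0) →
      ∀ c ∉ (chains n mu).subtype (IsSchurChain tau mu), tr m (chainWeight Xa c.1) = 0 :=
    fun m n hn c hc => tr_chainWeight_eq_zero hn c.2 fun h => hc (mem_subtype.mpr h)
  rw [skewSchur, tr_tsum (summable_of_tr fun m => ?_) _ (h m n hn),
    Finset.sum_subtype_eq_sum_filter (f := fun c => tr m (chainWeight Xa c))]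
  obtain ⟨n, hn⟩ := exists_tr_Xa m
  exact ⟨_, Finset.finite_toSet _, fun c hc => h m n hn c hc⟩

theorem sum_tr_skewSchur {m : ℕ ⊕ Unit →₀ ℕ} {n N : ℕ} (hn : ∀ i, n ≤ i → m (Sum.inl i) = 0)
    {mu : Ptn} (hmu : mu.size ≤ N) :
    ∑ tau ∈ (finite_size_le N).toFinset, tr m (skewSchur Xa mu tau) =
      tr m (lowerIter Xa n mu) := by
  classical
  simp only [tr_skewSchur hn, sum_filter]
  rw [sum_comm, ← sum_chains, map_sum]
  refine Finset.sum_congr rfl fun c hc => ?_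
  obtain ⟨hs, hc'⟩ := mem_chains.mp hc
  have hchain : IsSchurChain (c 0) mu c := ⟨rfl, hs, n, hc'⟩
  rw [sum_eq_single (c 0) (fun tau _ hne => if_neg fun h => hne h.1.symm)
    fun h => absurd ((size_le_of_isSchurChain hchain 0).trans hmu) (by simpa using h),
    if_pos hchain, chainWeight_eq_prod Xa hc']

theorem tr_tsum_skewSchur {m : ℕ ⊕ Unit →₀ ℕ} {n : ℕ} (hn : ∀ i, n ≤ i → m (Sum.inl i) = 0) :
    tr m (∑' p : Ptn × Ptn, z ^ p.1.size * skewSchur Xa p.1 p.2) = tr m (genFin Xa n) := by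
  have h : ∀ (m : ℕ ⊕ Unit →₀ ℕ), ∀ p ∉ (finite_size_le (m (Sum.inr ()))).toFinset ×ˢ
      (finite_size_le (m (Sum.inr ()))).toFinset,
      tr m (z ^ p.1.size * skewSchur Xa p.1 p.2) = 0 := fun m p hp => by
    by_cases h1 : m (Sum.inr ()) < p.1.size
    · rw [map_mul, tr_z_pow_eq_zero h1, zero_mul]
    · have h2 : p.1.size < p.2.size := by
        by_contra h2
        exact hp (by simp; omega)
      rw [skewSchur_eq_zero h2, mul_zero, map_zero]
  rw [tr_tsum (summable_of_tr fun m => ⟨_, Finset.finite_toSet _, h m⟩) _ (h m), sum_product,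
    genFin, pairing, tr_tsum (summable_pairing _ _) (finite_size_le (m (Sum.inr ()))).toFinset
      fun mu hmu => by rw [map_mul, tr_z_pow_eq_zero (by simpa using hmu), zero_mul]]
  refine Finset.sum_congr rfl fun mu hmu => ?_
  simp only [map_mul]
  rw [← mul_sum, sum_tr_skewSchur hn (by simpa using hmu)]
  simp

end SchurSum

/-- **Lemma 2.3**: `Σ_{μ,τ} z^{|μ|} s_{μ/τ}(X) = ∏_{k≥1} Φ(z^k X)/(1-z^k)`. -/
theorem sum_skewSchur_eq :
    ∑' p : Ptn × Ptn, z ^ p.1.size * skewSchur Xa p.1 p.2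
    = ∏' k : ℕ, Phi (fun n => z ^ (k + 1) * Xa n) * (1 - z ^ (k + 1))⁻¹ := by
  refine SchurSum.eq_of_tr fun m => ?_
  obtain ⟨n, hn⟩ := SchurSum.exists_tr_Xa m
  have hN := Nat.lt_succ_self (m (Sum.inr ()))
  rw [SchurSum.tr_tsum_skewSchur hn, SchurSum.tr_tprod_Phi hn hN,
    SchurSum.genFin_eq_prod Xa n, map_mul, SchurSum.tr_genFin_z_pow hN, SchurSum.partGen_eq_prod,
    map_mul]
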